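/- Let C be a rectifiable closed curve in ℝ³, p a point in its convex hull, K the p-cone of C, and 0 ≤ ε ≤ 1. Let x, y ∈ ℝ³ with dist(x, im C) ≥ 1, dist(y, im C) ≥ 1, dist(x, K) ≤ ε, and dist(y, K) ≤ ε. Then length(C) ≥ 2π + 2‖x − y‖ − (2π + 4)ε. -/

import Mathlib

/-- The cosine, cut off to zero outside `[-π/2, π/2]`. -/
noncomputable def cutCos (x : ℝ) : ℝ :=
  Real.cos (max (-(Real.pi / 2)) (min x (Real.pi / 2)))

lemma continuous_cutCos : Continuous cutCos := by
  unfold cutCos; fun_prop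

lemma cutCos_eq_zero_of_le {x : ℝ} (hx : x ≤ -(Real.pi / 2)) : cutCos x = 0 := by
  have := Real.pi_pos
  rw [cutCos, min_eq_left (by linarith), max_eq_left hx, Real.cos_neg, Real.cos_pi_div_two]

lemma cutCos_eq_zero_of_ge {x : ℝ} (hx : Real.pi / 2 ≤ x) : cutCos x = 0 := by
  have := Real.pi_pos
  rw [cutCos, min_eq_right hx, max_eq_right (by linarith), Real.cos_pi_div_two]

lemma cutCos_eq_max {x : ℝ} (hx : |x| ≤ 3 * Real.pi / 2) :
    cutCos x = max (Real.cos x) 0 := by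
  have hpi := Real.pi_pos
  rw [abs_le] at hx
  rcases le_total x (-(Real.pi / 2)) with h | h
  · rw [cutCos_eq_zero_of_le h, max_eq_right]
    rw [← Real.cos_neg]
    exact Real.cos_nonpos_of_pi_div_two_le_of_le (by linarith) (by linarith)
  rcases le_total x (Real.pi / 2) with h' | h'
  · rw [cutCos, min_eq_left h', max_eq_right h,
      max_eq_left (Real.cos_nonneg_of_mem_Icc ⟨h, h'⟩)]
  · rw [cutCos_eq_zero_of_ge h', max_eq_right]
    exact Real.cos_nonpos_of_pi_div_two_le_of_le h' (by linarith)

lemma integral_abs_cos_period (c : ℝ) :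
    ∫ θ in (c - Real.pi)..(c + Real.pi), |Real.cos θ| = 4 := by
  have hper : Function.Periodic (fun θ : ℝ => |Real.cos θ|) (2 * Real.pi) := fun θ => by
    simp
  have hpi := Real.pi_pos
  have h := hper.intervalIntegral_add_eq (c - Real.pi) (-(Real.pi / 2))
  rw [show c - Real.pi + 2 * Real.pi = c + Real.pi by ring] at h
  rw [h, ← intervalIntegral.integral_add_adjacent_intervals (b := Real.pi / 2)
    (Continuous.intervalIntegrable (by fun_prop) _ _)
    (Continuous.intervalIntegrable (by fun_prop) _ _)]
  have h1 : ∫ θ in (-(Real.pi / 2))..(Real.pi / 2), |Real.cos θ| =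
      ∫ θ in (-(Real.pi / 2))..(Real.pi / 2), Real.cos θ := by
    refine intervalIntegral.integral_congr fun θ hθ => ?_
    rw [Set.uIcc_of_le (by linarith)] at hθ
    exact abs_of_nonneg (Real.cos_nonneg_of_mem_Icc hθ)
  have h2 : ∫ θ in (Real.pi / 2)..(-(Real.pi / 2) + 2 * Real.pi), |Real.cos θ| =
      ∫ θ in (Real.pi / 2)..(-(Real.pi / 2) + 2 * Real.pi), -Real.cos θ := by
    refine intervalIntegral.integral_congr fun θ hθ => ?_
    rw [Set.uIcc_of_le (by linarith)] at hθ
    exact abs_of_nonpos (Real.cos_nonpos_of_pi_div_two_le_of_le hθ.1 (by linarith [hθ.2]))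
  rw [h1, h2, intervalIntegral.integral_neg, integral_cos, integral_cos, Real.sin_neg,
    Real.sin_pi_div_two, Real.sin_add_two_pi, Real.sin_neg, Real.sin_pi_div_two]
  norm_num

/-- The difference of two cosine waves is again a cosine wave, whose amplitude is given by the
law of cosines. -/
lemma exists_cos_sub_cos_eq (a b α β ℓ : ℝ) (hℓ : 0 ≤ ℓ)
    (h : ℓ ^ 2 = a ^ 2 + b ^ 2 - 2 * a * b * Real.cos (α - β)) :
    ∃ τ, ∀ θ, a * Real.cos (θ - α) - b * Real.cos (θ - β) = ℓ * Real.cos (θ - τ) := by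
  set z : ℂ := ⟨a * Real.cos α - b * Real.cos β, a * Real.sin α - b * Real.sin β⟩ with hz
  have hnorm : ‖z‖ = ℓ := by
    rw [← sq_eq_sq₀ (norm_nonneg _) hℓ, h, Complex.sq_norm, Complex.normSq_apply, Real.cos_sub]
    simp only [hz]
    linear_combination a ^ 2 * Real.sin_sq_add_cos_sq α + b ^ 2 * Real.sin_sq_add_cos_sq β
  refine ⟨z.arg, fun θ => ?_⟩
  have h1 : ℓ * Real.cos z.arg = a * Real.cos α - b * Real.cos β := by
    rw [← hnorm, Complex.norm_mul_cos_arg]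
  have h2 : ℓ * Real.sin z.arg = a * Real.sin α - b * Real.sin β := by
    rw [← hnorm, Complex.norm_mul_sin_arg]
  simp only [Real.cos_sub]
  linear_combination -Real.cos θ * h1 - Real.sin θ * h2

lemma integral_abs_cos_sub_cos (a b α β ℓ c : ℝ) (hℓ : 0 ≤ ℓ)
    (h : ℓ ^ 2 = a ^ 2 + b ^ 2 - 2 * a * b * Real.cos (α - β)) :
    ∫ θ in (c - Real.pi)..(c + Real.pi), |a * Real.cos (θ - α) - b * Real.cos (θ - β)| =
      4 * ℓ := by
  obtain ⟨τ, hτ⟩ := exists_cos_sub_cos_eq a b α β ℓ hℓ h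
  simp_rw [hτ, abs_mul, abs_of_nonneg hℓ]
  rw [intervalIntegral.integral_const_mul,
    intervalIntegral.integral_comp_sub_right (fun θ => |Real.cos θ|) τ,
    show c - Real.pi - τ = (c - τ) - Real.pi by ring,
    show c + Real.pi - τ = (c - τ) + Real.pi by ring, integral_abs_cos_period]
  ring

lemma integral_max_cos_cos (a b α β ℓ c : ℝ) (hℓ : 0 ≤ ℓ)
    (h : ℓ ^ 2 = a ^ 2 + b ^ 2 - 2 * a * b * Real.cos (α - β)) :
    ∫ θ in (c - Real.pi)..(c + Real.pi), max (a * Real.cos (θ - α)) (b * Real.cos (θ - β)) =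
      2 * ℓ := by
  have hcos : ∀ k γ : ℝ, ∫ θ in (c - Real.pi)..(c + Real.pi), k * Real.cos (θ - γ) = 0 := by
    intro k γ
    rw [intervalIntegral.integral_const_mul, intervalIntegral.integral_comp_sub_right,
      integral_cos, show c + Real.pi - γ = (c - Real.pi - γ) + 2 * Real.pi by ring,
      Real.sin_add_two_pi, sub_self, mul_zero]
  have hmax : ∀ x y : ℝ, max x y = 2⁻¹ * (x + y + |x - y|) := fun x y => by
    rcases le_total x y with hxy | hxy
    · rw [max_eq_right hxy, abs_of_nonpos (by linarith)]; ring
    · rw [max_eq_left hxy, abs_of_nonneg (by linarith)]; ring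
  simp_rw [hmax]
  rw [intervalIntegral.integral_const_mul, intervalIntegral.integral_add
    (Continuous.intervalIntegrable (by fun_prop) _ _)
    (Continuous.intervalIntegrable (by fun_prop) _ _), intervalIntegral.integral_add
    (Continuous.intervalIntegrable (by fun_prop) _ _)
    (Continuous.intervalIntegrable (by fun_prop) _ _), hcos, hcos,
    integral_abs_cos_sub_cos a b α β ℓ c hℓ h]
  ring

lemma integral_abs_max_cos_sub_max_cos (a b α β ℓ c : ℝ) (hℓ : 0 ≤ ℓ)
    (h : ℓ ^ 2 = a ^ 2 + b ^ 2 - 2 * a * b * Real.cos (α - β)) :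
    ∫ θ in (c - Real.pi)..(c + Real.pi),
      |max (a * Real.cos (θ - α)) 0 - max (b * Real.cos (θ - β)) 0| = 2 * ℓ := by
  set f : ℝ → ℝ := fun θ => |max (a * Real.cos (θ - α)) 0 - max (b * Real.cos (θ - β)) 0|
    with hf
  have hfc : Continuous f := by fun_prop
  have hper : Function.Periodic f (2 * Real.pi) := fun θ => by
    simp only [hf]
    rw [show θ + 2 * Real.pi - α = θ - α + 2 * Real.pi by ring,
      show θ + 2 * Real.pi - β = θ - β + 2 * Real.pi by ring, Real.cos_add_two_pi,
      Real.cos_add_two_pi]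
  have hshift : ∫ θ in (c - Real.pi)..(c + Real.pi), f (θ + Real.pi) =
      ∫ θ in (c - Real.pi)..(c + Real.pi), f θ := by
    rw [intervalIntegral.integral_comp_add_right f Real.pi]
    have := hper.intervalIntegral_add_eq (c - Real.pi + Real.pi) (c - Real.pi)
    rwa [show c - Real.pi + Real.pi + 2 * Real.pi = c + Real.pi + Real.pi by ring,
      show c - Real.pi + 2 * Real.pi = c + Real.pi by ring] at this
  have hsplit : ∀ x y : ℝ, |max x 0 - max y 0| + |max (-x) 0 - max (-y) 0| = |x - y| := by
    intro x y
    rcases le_total x 0 with hx | hx <;> rcases le_total y 0 with hy | hy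
    · rw [max_eq_right hx, max_eq_right hy, max_eq_left (by linarith), max_eq_left (by linarith),
        ← abs_neg (x - y)]
      simp; congr 1; ring
    · rw [max_eq_right hx, max_eq_left hy, max_eq_left (by linarith), max_eq_right (by linarith),
        abs_of_nonpos (by linarith), abs_of_nonneg (by linarith), abs_of_nonpos (by linarith)]
      ring
    · rw [max_eq_left hx, max_eq_right hy, max_eq_right (by linarith), max_eq_left (by linarith),
        abs_of_nonneg (by linarith), abs_of_nonpos (by linarith), abs_of_nonneg (by linarith)]
      ring
    · rw [max_eq_left hx, max_eq_left hy, max_eq_right (by linarith), max_eq_right (by linarith)]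
      simp
  have hsum : ∀ θ, f θ + f (θ + Real.pi) =
      |a * Real.cos (θ - α) - b * Real.cos (θ - β)| := by
    intro θ
    simp only [hf]
    rw [show θ + Real.pi - α = θ - α + Real.pi by ring,
      show θ + Real.pi - β = θ - β + Real.pi by ring, Real.cos_add_pi, Real.cos_add_pi,
      mul_neg, mul_neg, hsplit]
  have key := integral_abs_cos_sub_cos a b α β ℓ c hℓ h
  simp_rw [← hsum] at key
  rw [intervalIntegral.integral_add (hfc.intervalIntegrable _ _)
    (Continuous.intervalIntegrable (by fun_prop) _ _), hshift] at key
  linarith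

/-- Cauchy–Crofton estimate for one edge of a developed polygon. -/
lemma integral_abs_cutCos_sub_cutCos_le {a b α β ℓ : ℝ} (ha : 0 ≤ a) (hb : 0 ≤ b) (hℓ : 0 ≤ ℓ)
    (hαβ : α ≤ β) (hβα : β ≤ α + Real.pi)
    (h : ℓ ^ 2 = a ^ 2 + b ^ 2 - 2 * a * b * Real.cos (α - β)) {s t : ℝ} (hst : s ≤ t) :
    ∫ θ in s..t, |a * cutCos (θ - α) - b * cutCos (θ - β)| ≤ 2 * ℓ := by
  have hpi := Real.pi_pos
  set f : ℝ → ℝ := fun θ => |a * cutCos (θ - α) - b * cutCos (θ - β)| with hf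
  have hfc : Continuous f := by
    have := continuous_cutCos
    fun_prop
  have hf0 : ∀ θ, 0 ≤ f θ := fun θ => abs_nonneg _
  set c := (α + β) / 2 with hc
  have hleft : ∀ θ ≤ c - Real.pi, f θ = 0 := fun θ hθ => by
    simp only [hf]
    rw [cutCos_eq_zero_of_le (by linarith), cutCos_eq_zero_of_le (by linarith)]; simp
  have hright : ∀ θ, c + Real.pi ≤ θ → f θ = 0 := fun θ hθ => by
    simp only [hf]
    rw [cutCos_eq_zero_of_ge (by linarith), cutCos_eq_zero_of_ge (by linarith)]; simp
  have hmid : ∫ θ in (c - Real.pi)..(c + Real.pi), f θ = 2 * ℓ := by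
    rw [← integral_abs_max_cos_sub_max_cos a b α β ℓ c hℓ h]
    refine intervalIntegral.integral_congr fun θ hθ => ?_
    rw [Set.uIcc_of_le (by linarith)] at hθ
    obtain ⟨h1, h2⟩ := hθ
    simp only [hf]
    rw [cutCos_eq_max (abs_le.2 ⟨by linarith, by linarith⟩),
      cutCos_eq_max (abs_le.2 ⟨by linarith, by linarith⟩), mul_max_of_nonneg _ _ ha,
      mul_max_of_nonneg _ _ hb, mul_zero, mul_zero]
  set s' := min s (c - Real.pi)
  set t' := max t (c + Real.pi)
  have hI : ∀ x y, IntervalIntegrable f MeasureTheory.volume x y := fun x y =>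
    hfc.intervalIntegrable x y
  have hle : ∫ θ in s..t, f θ ≤ ∫ θ in s'..t', f θ :=
    intervalIntegral.integral_mono_interval (min_le_left _ _) hst (le_max_left _ _)
      (Filter.Eventually.of_forall hf0) (hI _ _)
  have h1 : ∫ θ in s'..(c - Real.pi), f θ = 0 := by
    rw [intervalIntegral.integral_congr (g := fun _ => 0)]
    · simp
    · intro θ hθ
      rw [Set.uIcc_of_le (min_le_right _ _)] at hθ
      exact hleft θ hθ.2
  have h2 : ∫ θ in (c + Real.pi)..t', f θ = 0 := by
    rw [intervalIntegral.integral_congr (g := fun _ => 0)]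
    · simp
    · intro θ hθ
      rw [Set.uIcc_of_le (le_max_right _ _)] at hθ
      exact hright θ hθ.1
  have h3 := intervalIntegral.integral_add_adjacent_intervals (hI s' (c - Real.pi))
    (hI (c - Real.pi) (c + Real.pi))
  have h4 := intervalIntegral.integral_add_adjacent_intervals (hI s' (c + Real.pi))
    (hI (c + Real.pi) t')
  linarith

/-- Polar coordinates `(ρ i, φ i)` of a closed polygon with `n` vertices on a flat cone of total
angle `Θ ≥ 2π`, unrolled to a periodic sequence; `ℓ i` is the length of the `i`-th edge. -/
structure IsConePolygon (n : ℕ) (Θ : ℝ) (ρ φ ℓ : ℕ → ℝ) : Prop where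
  two_pi_le : 2 * Real.pi ≤ Θ
  angle_zero : φ 0 = 0
  radius_nonneg : ∀ i, 0 ≤ ρ i
  radius_add : ∀ i, ρ (i + n) = ρ i
  angle_add : ∀ i, φ (i + n) = φ i + Θ
  angle_le_succ : ∀ i, φ i ≤ φ (i + 1)
  angle_succ_le : ∀ i, φ (i + 1) ≤ φ i + Real.pi
  length_nonneg : ∀ i, 0 ≤ ℓ i
  length_sq : ∀ i, ℓ i ^ 2 =
    ρ i ^ 2 + ρ (i + 1) ^ 2 - 2 * ρ i * ρ (i + 1) * Real.cos (φ i - φ (i + 1))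

namespace IsConePolygon

variable {n : ℕ} {Θ : ℝ} {ρ φ ℓ : ℕ → ℝ}

lemma monotone_angle (h : IsConePolygon n Θ ρ φ ℓ) : Monotone φ :=
  monotone_nat_of_le_succ h.angle_le_succ

lemma angle_mul (h : IsConePolygon n Θ ρ φ ℓ) (K : ℕ) : φ (K * n) = K * Θ := by
  induction K with
  | zero => simp [h.angle_zero]
  | succ K ih => rw [Nat.succ_mul, h.angle_add, ih]; push_cast; ring

lemma exists_angle_ge (h : IsConePolygon n Θ ρ φ ℓ) (x : ℝ) : ∃ K : ℕ, x ≤ φ (K * n) := by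
  have hΘ : 0 < Θ := by linarith [Real.pi_pos, h.two_pi_le]
  obtain ⟨K, hK⟩ := exists_nat_ge (x / Θ)
  exact ⟨K, by rwa [h.angle_mul, ← div_le_iff₀ hΘ]⟩

lemma angle_add_mul (h : IsConePolygon n Θ ρ φ ℓ) (j K : ℕ) :
    φ (K * n + j) = φ j + K * Θ := by
  induction K with
  | zero => simp
  | succ K ih =>
    rw [show (K + 1) * n + j = K * n + j + n by ring, h.angle_add, ih]; push_cast; ring

lemma radius_add_mul (h : IsConePolygon n Θ ρ φ ℓ) (j K : ℕ) :
    ρ (K * n + j) = ρ j := by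
  induction K with
  | zero => simp
  | succ K ih =>
    rw [show (K + 1) * n + j = K * n + j + n by ring, h.radius_add, ih]

/-- Variation, along the `i`-th edge, of the cut-off height function in direction `θ`. -/
noncomputable def edgeVariation (ρ φ : ℕ → ℝ) (i : ℕ) (θ : ℝ) : ℝ :=
  |ρ i * cutCos (θ - φ i) - ρ (i + 1) * cutCos (θ - φ (i + 1))|

lemma continuous_edgeVariation (ρ φ : ℕ → ℝ) (i : ℕ) : Continuous (edgeVariation ρ φ i) := by
  have := continuous_cutCos
  unfold edgeVariation
  fun_prop

lemma sum_integral_edgeVariation (h : IsConePolygon n Θ ρ φ ℓ) (α : ℝ) (K : ℕ) :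
    ∑ i ∈ Finset.range (K * n), ∫ θ in α..(α + Θ), edgeVariation ρ φ i θ =
      ∑ j ∈ Finset.range n, ∫ θ in (α + Θ - K * Θ)..(α + Θ), edgeVariation ρ φ j θ := by
  induction K with
  | zero => simp
  | succ K ih =>
    rw [Nat.succ_mul, Finset.sum_range_add, ih, ← Finset.sum_add_distrib]
    refine Finset.sum_congr rfl fun j _ => ?_
    have hshift : ∀ θ, edgeVariation ρ φ (K * n + j) θ = edgeVariation ρ φ j (θ - K * Θ) := by
      intro θ
      simp only [edgeVariation, add_assoc, h.angle_add_mul, h.radius_add_mul]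
      rw [show θ - (φ j + K * Θ) = θ - K * Θ - φ j by ring,
        show θ - (φ (j + 1) + K * Θ) = θ - K * Θ - φ (j + 1) by ring]
    simp_rw [hshift]
    rw [intervalIntegral.integral_comp_sub_right (edgeVariation ρ φ j), add_comm]
    push_cast
    rw [show α + Θ - (K + 1) * Θ = α - K * Θ by ring]
    exact intervalIntegral.integral_add_adjacent_intervals
      ((continuous_edgeVariation ρ φ j).intervalIntegrable _ _)
      ((continuous_edgeVariation ρ φ j).intervalIntegrable _ _)

/-- A Cauchy–Crofton inequality: the length of a polygon on a cone dominates the integral of its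
cut-off support function over one period of directions. -/
lemma exists_support_integral_le (h : IsConePolygon n Θ ρ φ ℓ) {α : ℝ}
    (hα : Real.pi / 2 ≤ α) :
    ∃ S : ℝ → ℝ, Continuous S ∧ (∀ θ, 0 ≤ S θ) ∧
      (∀ θ ∈ Set.Icc α (α + Θ), ∀ j, ρ j * cutCos (θ - φ j) ≤ S θ) ∧
      ∫ θ in α..(α + Θ), S θ ≤ ∑ i ∈ Finset.range n, ℓ i := by
  have hΘ : 0 < Θ := by linarith [Real.pi_pos, h.two_pi_le]
  obtain ⟨K, hK⟩ := h.exists_angle_ge (α + Θ + Real.pi / 2)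
  have hS0 : ∀ θ, 0 ≤ 2⁻¹ * ∑ i ∈ Finset.range (K * n), edgeVariation ρ φ i θ := fun θ =>
    mul_nonneg (by norm_num) (Finset.sum_nonneg fun i _ => abs_nonneg _)
  refine ⟨fun θ => 2⁻¹ * ∑ i ∈ Finset.range (K * n), edgeVariation ρ φ i θ, ?_, hS0, ?_, ?_⟩
  · have := continuous_edgeVariation ρ φ
    fun_prop
  · intro θ hθ j
    set G : ℕ → ℝ := fun i => ρ i * cutCos (θ - φ i) with hG
    have hG0 : G 0 = 0 := by
      simp only [hG]
      rw [h.angle_zero, cutCos_eq_zero_of_ge (by linarith [hθ.1]), mul_zero]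
    have hGK : ∀ i, K * n ≤ i → G i = 0 := fun i hi => by
      have := h.monotone_angle hi
      simp only [hG]
      rw [cutCos_eq_zero_of_le (by linarith [hθ.2]), mul_zero]
    rcases le_total (K * n) j with hj | hj
    · exact (hGK j hj).le.trans (hS0 θ)
    have h1 : |G j - G 0| ≤ ∑ i ∈ Finset.range j, edgeVariation ρ φ i θ := by
      rw [← Finset.sum_range_sub]
      refine (Finset.abs_sum_le_sum_abs _ _).trans (Finset.sum_le_sum fun i _ => ?_)
      rw [abs_sub_comm]; rfl
    have h2 : |G (K * n) - G j| ≤ ∑ i ∈ Finset.Ico j (K * n), edgeVariation ρ φ i θ := by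
      rw [← Finset.sum_Ico_sub G hj]
      refine (Finset.abs_sum_le_sum_abs _ _).trans (Finset.sum_le_sum fun i _ => ?_)
      rw [abs_sub_comm]; rfl
    have h3 := Finset.sum_range_add_sum_Ico (fun i => edgeVariation ρ φ i θ) hj
    rw [hG0] at h1
    rw [hGK _ le_rfl] at h2
    have h4 := le_abs_self (G j - 0)
    have h5 := neg_abs_le (0 - G j)
    change G j ≤ _
    linarith
  · rw [intervalIntegral.integral_const_mul, intervalIntegral.integral_finsetSum fun i _ =>
      (continuous_edgeVariation ρ φ i).intervalIntegrable _ _, h.sum_integral_edgeVariation,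
      inv_mul_le_iff₀ two_pos, Finset.mul_sum]
    refine Finset.sum_le_sum fun i _ => ?_
    refine integral_abs_cutCos_sub_cutCos_le (h.radius_nonneg _) (h.radius_nonneg _)
      (h.length_nonneg _) (h.angle_le_succ _) (h.angle_succ_le _) (h.length_sq _) ?_
    have : 0 ≤ (K : ℝ) * Θ := by positivity
    linarith

end IsConePolygon

/-- If the segment from `(A, F)` to `(A', F')`, of length at most `δ`, passes through `(X + s, Y)`
with `0 ≤ s`, and `(A, F)` has distance at least `r` from `(X, Y)`, then `r - δ ≤ s`. -/
lemma sub_le_of_crossing {A A' F F' X Y r δ t s : ℝ} (hδ : 0 ≤ δ)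
    (hE : (A - A') ^ 2 + (F - F') ^ 2 ≤ δ ^ 2) (hD : r ^ 2 ≤ (A - X) ^ 2 + (F - Y) ^ 2)
    (ht0 : 0 ≤ t) (ht1 : t ≤ 1) (htF : F + t * (F' - F) = Y) (hs : A + t * (A' - A) = X + s)
    (hs0 : 0 ≤ s) : r - δ ≤ s := by
  have hdA : A - A' ≤ δ :=
    (abs_le.1 (abs_le_of_sq_le_sq (by linarith [sq_nonneg (F - F')]) hδ)).2
  have h1 : (A - X) ^ 2 + (F - Y) ^ 2 ≤ (s + δ) ^ 2 := by
    have e1 : A - X = s + t * (A - A') := by linarith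
    have e2 : F - Y = t * (F - F') := by linarith
    have h2 : t ^ 2 * ((A - A') ^ 2 + (F - F') ^ 2) ≤ 1 * δ ^ 2 :=
      mul_le_mul (pow_le_one₀ ht0 ht1) hE (by positivity) zero_le_one
    have h3 : t * (A - A') ≤ δ := by
      calc t * (A - A') ≤ t * δ := mul_le_mul_of_nonneg_left hdA ht0
        _ ≤ 1 * δ := mul_le_mul_of_nonneg_right ht1 hδ
        _ = δ := one_mul δ
    rw [e1, e2]
    linarith [mul_le_mul_of_nonneg_left h3 hs0]
  linarith [abs_le_of_sq_le_sq' (hD.trans h1) (by linarith)]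

/-- A chain of points in polar coordinates that starts beyond `(b, φ 0)` and reaches the direction
`θ` has a vertex that is about `r` farther in direction `θ` than `(b, φ 0)`, provided it keeps
distance `r` from that point. -/
lemma exists_mul_cos_ge_of_chain {ρ φ : ℕ → ℝ} {b r δ θ : ℝ} (hρ : ∀ i, 0 ≤ ρ i)
    (hb : 0 ≤ b) (hbρ : b ≤ ρ 0) (hδ : 0 ≤ δ)
    {m : ℕ} (hmono : ∀ i < m, φ i ≤ φ (i + 1)) (hstep : ∀ i < m, φ (i + 1) ≤ φ i + Real.pi)
    (hedge : ∀ i < m, ρ i ^ 2 + ρ (i + 1) ^ 2 - 2 * ρ i * ρ (i + 1) *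
      Real.cos (φ i - φ (i + 1)) ≤ δ ^ 2)
    (hdist : ∀ i ≤ m, φ i ≤ φ 0 + Real.pi →
      r ^ 2 ≤ ρ i ^ 2 + b ^ 2 - 2 * ρ i * b * Real.cos (φ i - φ 0))
    (hθ0 : φ 0 ≤ θ) (hθπ : θ < φ 0 + Real.pi) (hm : θ ≤ φ m) :
    ∃ j ≤ m, |θ - φ j| ≤ Real.pi ∧ r - δ + b * Real.cos (θ - φ 0) ≤ ρ j * Real.cos (θ - φ j) := by
  have hpi := Real.pi_pos
  have hfirst : r ≤ ρ 0 - b := by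
    have h0 := hdist 0 (Nat.zero_le _) (by linarith)
    rw [sub_self, Real.cos_zero] at h0
    nlinarith
  rcases hθ0.eq_or_lt with hθ0 | hθ0
  · refine ⟨0, Nat.zero_le _, by rw [hθ0]; simpa using hpi.le, ?_⟩
    rw [← hθ0, sub_self, Real.cos_zero]
    linarith
  have hsin : 0 < Real.sin (θ - φ 0) := Real.sin_pos_of_pos_of_lt_pi (by linarith) (by linarith)
  classical
  have hex : ∃ k, θ ≤ φ k := ⟨m, hm⟩
  obtain ⟨k, hk⟩ : ∃ k, k = Nat.find hex := ⟨_, rfl⟩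
  have hkθ : θ ≤ φ k := hk ▸ Nat.find_spec hex
  have hkm : k ≤ m := hk ▸ Nat.find_min' hex hm
  have hkmin : ∀ i < k, φ i < θ := fun i hi => not_le.1 (Nat.find_min hex (hk ▸ hi))
  have hk0 : k ≠ 0 := by rintro rfl; linarith
  have hkub : φ k ≤ θ + Real.pi := by
    obtain ⟨i, rfl⟩ := Nat.exists_eq_succ_of_ne_zero hk0
    linarith [hkmin i (Nat.lt_succ_self i), hstep i (by omega)]
  have hex' : ∃ j, ρ j * Real.sin (θ - φ j) ≤ b * Real.sin (θ - φ 0) := by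
    refine ⟨k, le_trans ?_ (mul_nonneg hb hsin.le)⟩
    exact mul_nonpos_of_nonneg_of_nonpos (hρ k)
      (Real.sin_nonpos_of_nonpos_of_neg_pi_le (by linarith) (by linarith))
  obtain ⟨j, hj⟩ : ∃ j, j = Nat.find hex' := ⟨_, rfl⟩
  have hjs : ρ j * Real.sin (θ - φ j) ≤ b * Real.sin (θ - φ 0) := hj ▸ Nat.find_spec hex'
  have hjk : j ≤ k := by
    rw [hj]
    refine Nat.find_min' hex' (le_trans ?_ (mul_nonneg hb hsin.le))
    exact mul_nonpos_of_nonneg_of_nonpos (hρ k)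
      (Real.sin_nonpos_of_nonpos_of_neg_pi_le (by linarith) (by linarith))
  have hjmin : ∀ i < j, b * Real.sin (θ - φ 0) < ρ i * Real.sin (θ - φ i) :=
    fun i hi => not_le.1 (Nat.find_min hex' (hj ▸ hi))
  rcases j with _ | i
  · have hρb : ρ 0 ≤ b := le_of_mul_le_mul_right hjs hsin
    refine ⟨0, Nat.zero_le _, abs_le.2 ⟨by linarith, by linarith⟩, ?_⟩
    rw [le_antisymm hρb hbρ]
    linarith
  have hi1 := hjmin i (Nat.lt_succ_self i)
  have hiθ := hkmin i (by omega)
  have him : i < m := by omega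
  have hstep_i := hstep i him
  have hmono_i := hmono i him
  have hφi0 : φ 0 ≤ φ i := by
    have : ∀ q, q ≤ i → φ 0 ≤ φ q := by
      intro q
      induction q with
      | zero => exact fun _ => le_rfl
      | succ q ih => exact fun hq => (ih (by omega)).trans (hmono q (by omega))
    exact this i le_rfl
  have hβ : 0 < Real.sin (θ - φ i) :=
    Real.sin_pos_of_pos_of_lt_pi (by linarith) (by linarith)
  set F := ρ i * Real.sin (θ - φ i) with hF
  set F' := ρ (i + 1) * Real.sin (θ - φ (i + 1)) with hF'
  set A := ρ i * Real.cos (θ - φ i) with hA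
  set A' := ρ (i + 1) * Real.cos (θ - φ (i + 1)) with hA'
  set Y := b * Real.sin (θ - φ 0) with hY
  set X := b * Real.cos (θ - φ 0) with hX
  have hcoord : ∀ x y c d : ℝ, x ^ 2 + y ^ 2 - 2 * x * y * Real.cos (c - d) =
      (x * Real.cos (θ - c) - y * Real.cos (θ - d)) ^ 2 +
      (x * Real.sin (θ - c) - y * Real.sin (θ - d)) ^ 2 := by
    intro x y c d
    rw [show c - d = (θ - d) - (θ - c) by ring, Real.cos_sub]
    linear_combination -x ^ 2 * Real.sin_sq_add_cos_sq (θ - c) -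
      y ^ 2 * Real.sin_sq_add_cos_sq (θ - d)
  have hE := hedge i him
  rw [hcoord] at hE
  have hD := hdist i him.le (by linarith)
  rw [hcoord] at hD
  rw [← hF, ← hF', ← hA, ← hA'] at hE
  rw [← hF, ← hY, ← hA, ← hX] at hD
  -- the point where the edge crosses the ray from `(b, φ 0)` in direction `θ`
  obtain ⟨t, ht0, ht1, htF⟩ : ∃ t : ℝ, 0 ≤ t ∧ t ≤ 1 ∧ F + t * (F' - F) = Y := by
    have hpos : 0 < F - F' := by linarith
    refine ⟨(F - Y) / (F - F'), div_nonneg (by linarith) hpos.le,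
      (div_le_one hpos).2 (by linarith), ?_⟩
    field_simp
    ring
  obtain ⟨s, hs⟩ : ∃ s, A + t * (A' - A) = X + s := ⟨A + t * (A' - A) - X, by ring⟩
  have hs0 : 0 ≤ s := by
    have h1 : 0 ≤ Real.sin (θ - φ i) * A' - Real.cos (θ - φ i) * F' := by
      have : Real.sin (θ - φ i) * A' - Real.cos (θ - φ i) * F' =
          ρ (i + 1) * Real.sin (φ (i + 1) - φ i) := by
        rw [show φ (i + 1) - φ i = (θ - φ i) - (θ - φ (i + 1)) by ring,
          Real.sin_sub (θ - φ i)]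
        simp only [hA', hF']; ring
      rw [this]
      exact mul_nonneg (hρ _) (Real.sin_nonneg_of_nonneg_of_le_pi (by linarith) (by linarith))
    have h2 : Real.sin (θ - φ i) * A - Real.cos (θ - φ i) * F = 0 := by
      simp only [hA, hF]; ring
    have h3 : Real.sin (θ - φ i) * X - Real.cos (θ - φ i) * Y ≤ 0 := by
      have : Real.sin (θ - φ i) * X - Real.cos (θ - φ i) * Y =
          -(b * Real.sin (φ i - φ 0)) := by
        rw [show φ i - φ 0 = (θ - φ 0) - (θ - φ i) by ring,
          Real.sin_sub (θ - φ 0)]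
        simp only [hX, hY]; ring
      rw [this, neg_nonpos]
      exact mul_nonneg hb (Real.sin_nonneg_of_nonneg_of_le_pi (by linarith) (by linarith))
    have h4 : 0 ≤ Real.sin (θ - φ i) * s := by
      have h5 := mul_nonneg ht0 h1
      have h6 : Real.sin (θ - φ i) * s =
          t * (Real.sin (θ - φ i) * A' - Real.cos (θ - φ i) * F') -
          (Real.sin (θ - φ i) * X - Real.cos (θ - φ i) * Y) +
          (1 - t) * (Real.sin (θ - φ i) * A - Real.cos (θ - φ i) * F) := by
        linear_combination -Real.sin (θ - φ i) * hs + Real.cos (θ - φ i) * htF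
      rw [h6, h2]
      linarith
    exact nonneg_of_mul_nonneg_right h4 hβ
  have hsr : r - δ ≤ s := sub_le_of_crossing hδ hE hD ht0 ht1 htF hs hs0
  have habs : |θ - φ i| ≤ Real.pi ∧ |θ - φ (i + 1)| ≤ Real.pi := by
    constructor <;> rw [abs_le] <;> constructor <;> linarith
  rcases le_total A A' with hAA | hAA
  · exact ⟨i + 1, by omega, habs.2, by nlinarith [mul_nonneg (sub_nonneg.2 ht1) (sub_nonneg.2 hAA)]⟩
  · exact ⟨i, by omega, habs.1, by nlinarith [mul_nonneg ht0 (sub_nonneg.2 hAA)]⟩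

namespace IsConePolygon

variable {n : ℕ} {Θ : ℝ} {ρ φ ℓ : ℕ → ℝ}

/-- The cut-off support function of a cone polygon with edges shorter than `δ`, keeping distance
`r` from a point `(a, φ i)` on the cone, is at least that of the disk around the point of radius
`r - δ`. -/
lemma exists_support_ge (h : IsConePolygon n Θ ρ φ ℓ) {i : ℕ} {a r δ θ : ℝ}
    (ha : 0 ≤ a) (hai : a ≤ ρ i) (hδ : 0 ≤ δ) (hℓ : ∀ j, ℓ j ≤ δ)
    (hdist : ∀ j, |φ j - φ i| ≤ Real.pi →
      r ^ 2 ≤ ρ j ^ 2 + a ^ 2 - 2 * ρ j * a * Real.cos (φ j - φ i))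
    (hi : Θ ≤ φ i) (hθ : |θ - φ i| < Real.pi) :
    ∃ j, r - δ + a * Real.cos (θ - φ i) ≤ ρ j * cutCos (θ - φ j) := by
  have hpi := Real.pi_pos
  have hedge : ∀ j, ρ j ^ 2 + ρ (j + 1) ^ 2 - 2 * ρ j * ρ (j + 1) *
      Real.cos (φ j - φ (j + 1)) ≤ δ ^ 2 := fun j => by
    rw [← h.length_sq]
    exact pow_le_pow_left₀ (h.length_nonneg j) (hℓ j) 2
  suffices hcos : ∃ j, |θ - φ j| ≤ Real.pi ∧
      r - δ + a * Real.cos (θ - φ i) ≤ ρ j * Real.cos (θ - φ j) by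
    obtain ⟨j, hj, hle⟩ := hcos
    refine ⟨j, hle.trans (mul_le_mul_of_nonneg_left ?_ (h.radius_nonneg j))⟩
    rw [cutCos_eq_max (hj.trans (by linarith))]
    exact le_max_left _ _
  rw [abs_lt] at hθ
  rcases le_total (φ i) θ with hle | hle
  · obtain ⟨K, hK⟩ := h.exists_angle_ge θ
    obtain ⟨j, -, hj⟩ := exists_mul_cos_ge_of_chain (ρ := fun k => ρ (i + k))
      (φ := fun k => φ (i + k)) (b := a) (r := r) (δ := δ) (θ := θ) (m := K * n)
      (fun k => h.radius_nonneg _) ha hai hδ (fun k _ => h.angle_le_succ _)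
      (fun k _ => h.angle_succ_le _) (fun k _ => hedge (i + k))
      (fun k _ hk => hdist _ (abs_le.2
        ⟨by linarith [h.monotone_angle (Nat.le_add_right i k)], by
          simp only [add_zero] at hk; linarith⟩))
      hle (by simp only [add_zero]; linarith)
      (hK.trans (h.monotone_angle (Nat.le_add_left _ _)))
    exact ⟨i + j, hj⟩
  · have hpred : ∀ k < i, i - k = (i - (k + 1)) + 1 := fun k hk => by omega
    obtain ⟨j, -, hj1, hj2⟩ := exists_mul_cos_ge_of_chain (ρ := fun k => ρ (i - k))
      (φ := fun k => -φ (i - k)) (b := a) (r := r) (δ := δ) (θ := -θ) (m := i)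
      (fun k => h.radius_nonneg _) ha hai hδ
      (fun k hk => by
        have := h.angle_le_succ (i - (k + 1))
        rw [← hpred k hk] at this
        linarith)
      (fun k hk => by
        have := h.angle_succ_le (i - (k + 1))
        rw [← hpred k hk] at this
        linarith)
      (fun k hk => by
        have := hedge (i - (k + 1))
        rw [← hpred k hk] at this
        rw [show -φ (i - k) - -φ (i - (k + 1)) = φ (i - (k + 1)) - φ (i - k) by ring]
        linarith)
      (fun k _ hk => by
        simp only [Nat.sub_zero] at hk ⊢
        have := hdist (i - k) (abs_le.2
          ⟨by linarith, by linarith [h.monotone_angle (Nat.sub_le i k)]⟩)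
        rwa [show -φ (i - k) - -φ i = -(φ (i - k) - φ i) by ring, Real.cos_neg])
      (by simp only [Nat.sub_zero]; linarith) (by simp only [Nat.sub_zero]; linarith)
      (by simp only [Nat.sub_self, h.angle_zero]; linarith [h.two_pi_le])
    refine ⟨i - j, ?_, ?_⟩
    · rwa [show -θ - -φ (i - j) = -(θ - φ (i - j)) by ring, abs_neg] at hj1
    · simp only [Nat.sub_zero] at hj2
      rwa [show -θ - -φ (i - j) = -(θ - φ (i - j)) by ring,
        show -θ - -φ i = -(θ - φ i) by ring, Real.cos_neg, Real.cos_neg] at hj2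

lemma le_sum_length_of_angle_lt_pi (h : IsConePolygon n Θ ρ φ ℓ) {i₁ i₂ : ℕ} {a b d r δ : ℝ}
    (ha : 0 ≤ a) (hb : 0 ≤ b) (hd : 0 ≤ d) (hδ : 0 ≤ δ) (hℓ : ∀ j, ℓ j ≤ δ)
    (ha₁ : a ≤ ρ i₁) (hb₂ : b ≤ ρ i₂)
    (hdist₁ : ∀ j, |φ j - φ i₁| ≤ Real.pi →
      r ^ 2 ≤ ρ j ^ 2 + a ^ 2 - 2 * ρ j * a * Real.cos (φ j - φ i₁))
    (hdist₂ : ∀ j, |φ j - φ i₂| ≤ Real.pi →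
      r ^ 2 ≤ ρ j ^ 2 + b ^ 2 - 2 * ρ j * b * Real.cos (φ j - φ i₂))
    (hi₁ : Θ ≤ φ i₁) (h₁₂ : φ i₁ ≤ φ i₂) (hlt : φ i₂ < φ i₁ + Real.pi)
    (hdab : d ^ 2 = a ^ 2 + b ^ 2 - 2 * a * b * Real.cos (φ i₁ - φ i₂)) :
    2 * Real.pi * (r - δ) + 2 * d ≤ ∑ i ∈ Finset.range n, ℓ i := by
  have hpi := Real.pi_pos
  have hΘ := h.two_pi_le
  set D : ℝ → ℝ := fun θ => a * Real.cos (θ - φ i₁) - b * Real.cos (θ - φ i₂) with hD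
  have hDc : Continuous D := by fun_prop
  have hanti : AntitoneOn D (Set.Icc (φ i₁) (φ i₂)) := by
    intro x hx y hy hxy
    have h1 : Real.cos (y - φ i₁) ≤ Real.cos (x - φ i₁) :=
      Real.cos_le_cos_of_nonneg_of_le_pi (by linarith [hx.1]) (by linarith [hy.2])
        (by linarith)
    have h2 : Real.cos (x - φ i₂) ≤ Real.cos (y - φ i₂) := by
      rw [← Real.cos_neg (x - φ i₂), ← Real.cos_neg (y - φ i₂)]
      exact Real.cos_le_cos_of_nonneg_of_le_pi (by linarith [hy.2]) (by linarith [hx.1])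
        (by linarith)
    have h3 := mul_le_mul_of_nonneg_left h1 ha
    have h4 := mul_le_mul_of_nonneg_left h2 hb
    simp only [hD]
    linarith
  -- the direction in which both points are equally high
  obtain ⟨c, hc, hcl, hcr⟩ : ∃ c ∈ Set.Icc (φ i₁) (φ i₂),
      (∀ x, φ i₁ ≤ x → x < c → 0 ≤ D x) ∧ (∀ x, c < x → x ≤ φ i₂ → D x ≤ 0) := by
    rcases le_total (D (φ i₁)) 0 with h1 | h1
    · refine ⟨φ i₁, ⟨le_rfl, h₁₂⟩, fun x hx hx' => absurd hx (not_le.2 hx'), fun x hx hx' => ?_⟩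
      exact (hanti ⟨le_rfl, h₁₂⟩ ⟨hx.le, hx'⟩ hx.le).trans h1
    rcases le_total 0 (D (φ i₂)) with h2 | h2
    · refine ⟨φ i₂, ⟨h₁₂, le_rfl⟩, fun x hx hx' => ?_, fun x hx hx' => absurd hx' (not_le.2 hx)⟩
      exact h2.trans (hanti ⟨hx, hx'.le⟩ ⟨h₁₂, le_rfl⟩ hx'.le)
    obtain ⟨c, hc, hc0⟩ := intermediate_value_Icc' h₁₂ hDc.continuousOn ⟨h2, h1⟩
    refine ⟨c, hc, fun x hx hx' => ?_, fun x hx hx' => ?_⟩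
    · rw [← hc0]; exact hanti ⟨hx, hx'.le.trans hc.2⟩ hc hx'.le
    · rw [← hc0]; exact hanti hc ⟨hc.1.trans hx.le, hx'⟩ hx.le
  obtain ⟨S, hSc, hS0, hS, hSle⟩ := h.exists_support_integral_le (α := c - Real.pi)
    (by linarith [hc.1])
  refine le_trans ?_ ((intervalIntegral.integral_mono_interval (a := c - Real.pi)
    (b := c + Real.pi) le_rfl (by linarith) (by linarith) (Filter.Eventually.of_forall hS0)
    (hSc.intervalIntegrable _ _)).trans hSle)
  have hmax : ∫ θ in (c - Real.pi)..(c + Real.pi), ((r - δ) +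
      max (a * Real.cos (θ - φ i₁)) (b * Real.cos (θ - φ i₂))) =
      2 * Real.pi * (r - δ) + 2 * d := by
    rw [intervalIntegral.integral_add (Continuous.intervalIntegrable (by fun_prop) _ _)
      (Continuous.intervalIntegrable (by fun_prop) _ _),
      integral_max_cos_cos a b (φ i₁) (φ i₂) d c hd hdab, intervalIntegral.integral_const,
      smul_eq_mul]
    ring
  rw [← hmax]
  refine intervalIntegral.integral_mono_on_of_le_Ioo (by linarith)
    (Continuous.intervalIntegrable (by fun_prop) _ _) (hSc.intervalIntegrable _ _)
    fun θ hθ => ?_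
  have hsupp := hS θ ⟨hθ.1.le, by linarith [hθ.2]⟩
  have hx : |θ - φ i₁| < Real.pi → r - δ + a * Real.cos (θ - φ i₁) ≤ S θ := fun hθ₁ => by
    obtain ⟨j, hj⟩ := h.exists_support_ge ha ha₁ hδ hℓ hdist₁ hi₁ hθ₁
    exact hj.trans (hsupp j)
  have hy : |θ - φ i₂| < Real.pi → r - δ + b * Real.cos (θ - φ i₂) ≤ S θ := fun hθ₂ => by
    obtain ⟨j, hj⟩ := h.exists_support_ge hb hb₂ hδ hℓ hdist₂ (hi₁.trans h₁₂) hθ₂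
    exact hj.trans (hsupp j)
  have hDpi : ∀ x, D (x - Real.pi) = -D x ∧ D (x + Real.pi) = -D x := fun x => by
    simp only [hD]
    rw [show x - Real.pi - φ i₁ = x - φ i₁ - Real.pi by ring,
      show x - Real.pi - φ i₂ = x - φ i₂ - Real.pi by ring,
      show x + Real.pi - φ i₁ = x - φ i₁ + Real.pi by ring,
      show x + Real.pi - φ i₂ = x - φ i₂ + Real.pi by ring]
    simp only [Real.cos_sub_pi, Real.cos_add_pi]
    constructor <;> ring
  rw [← le_sub_iff_add_le', max_le_iff, le_sub_iff_add_le', le_sub_iff_add_le']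
  obtain ⟨hθ1, hθ2⟩ := hθ
  rcases le_or_gt (φ i₁ + Real.pi) θ with hθ₁ | hθ₁
  · have hθy := hy (abs_lt.2 ⟨by linarith, by linarith [hc.2]⟩)
    have h1 := hcl (θ - Real.pi) (by linarith) (by linarith)
    rw [(hDpi θ).1] at h1
    simp only [hD] at h1
    exact ⟨by linarith, hθy⟩
  have hθx := hx (abs_lt.2 ⟨by linarith [hc.1], by linarith⟩)
  rcases le_or_gt θ (φ i₂ - Real.pi) with hθ₂ | hθ₂
  · have h1 := hcr (θ + Real.pi) (by linarith) (by linarith)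
    rw [(hDpi θ).2] at h1
    simp only [hD] at h1
    exact ⟨hθx, by linarith⟩
  · exact ⟨hθx, hy (abs_lt.2 ⟨by linarith, by linarith [hc.2]⟩)⟩

lemma le_sum_length_of_pi_le_angle (h : IsConePolygon n Θ ρ φ ℓ) {i₁ i₂ : ℕ} {a b r δ : ℝ}
    (ha : 0 ≤ a) (hb : 0 ≤ b) (hδ : 0 ≤ δ) (hℓ : ∀ j, ℓ j ≤ δ)
    (ha₁ : a ≤ ρ i₁) (hb₂ : b ≤ ρ i₂)
    (hdist₁ : ∀ j, |φ j - φ i₁| ≤ Real.pi →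
      r ^ 2 ≤ ρ j ^ 2 + a ^ 2 - 2 * ρ j * a * Real.cos (φ j - φ i₁))
    (hdist₂ : ∀ j, |φ j - φ i₂| ≤ Real.pi →
      r ^ 2 ≤ ρ j ^ 2 + b ^ 2 - 2 * ρ j * b * Real.cos (φ j - φ i₂))
    (hi₁ : Θ ≤ φ i₁) (h₁₂ : φ i₁ + Real.pi ≤ φ i₂) (h₂₁ : φ i₂ + Real.pi ≤ φ i₁ + Θ) :
    2 * Real.pi * (r - δ) + 2 * (a + b) ≤ ∑ i ∈ Finset.range n, ℓ i := by
  have hpi := Real.pi_pos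
  have hΘ := h.two_pi_le
  obtain ⟨S, hSc, hS0, hS, hSle⟩ := h.exists_support_integral_le (α := φ i₁ - Real.pi / 2)
    (by linarith)
  have hI : ∀ x y, IntervalIntegrable S MeasureTheory.volume x y := fun x y =>
    hSc.intervalIntegrable x y
  have hwindow : ∀ {i : ℕ} {k : ℝ}, 0 ≤ k → k ≤ ρ i →
      (∀ j, |φ j - φ i| ≤ Real.pi →
        r ^ 2 ≤ ρ j ^ 2 + k ^ 2 - 2 * ρ j * k * Real.cos (φ j - φ i)) →
      φ i₁ ≤ φ i → φ i ≤ φ i₂ →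
      Real.pi * (r - δ) + 2 * k ≤
        ∫ θ in (φ i - Real.pi / 2)..(φ i + Real.pi / 2), S θ := by
    intro i k hk hki hdist h1 h2
    have hval : ∫ θ in (φ i - Real.pi / 2)..(φ i + Real.pi / 2),
        ((r - δ) + k * Real.cos (θ - φ i)) = Real.pi * (r - δ) + 2 * k := by
      rw [intervalIntegral.integral_add (Continuous.intervalIntegrable (by fun_prop) _ _)
        (Continuous.intervalIntegrable (by fun_prop) _ _), intervalIntegral.integral_const,
        intervalIntegral.integral_const_mul, intervalIntegral.integral_comp_sub_right,
        integral_cos, show φ i + Real.pi / 2 - φ i = Real.pi / 2 by ring,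
        show φ i - Real.pi / 2 - φ i = -(Real.pi / 2) by ring, Real.sin_neg,
        Real.sin_pi_div_two, smul_eq_mul]
      ring
    rw [← hval]
    refine intervalIntegral.integral_mono_on (by linarith)
      (Continuous.intervalIntegrable (by fun_prop) _ _) (hI _ _) fun θ hθ => ?_
    obtain ⟨hθ1, hθ2⟩ := hθ
    obtain ⟨j, hj⟩ := h.exists_support_ge (θ := θ) hk hki hδ hℓ hdist (hi₁.trans h1)
      (abs_lt.2 ⟨by linarith, by linarith⟩)
    exact hj.trans (hS θ ⟨by linarith, by linarith⟩ j)
  have hx := hwindow ha ha₁ hdist₁ le_rfl (by linarith)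
  have hy := hwindow hb hb₂ hdist₂ (by linarith) le_rfl
  have hgap : 0 ≤ ∫ θ in (φ i₁ + Real.pi / 2)..(φ i₂ - Real.pi / 2), S θ :=
    intervalIntegral.integral_nonneg (by linarith) fun θ _ => hS0 θ
  have hend : 0 ≤ ∫ θ in (φ i₂ + Real.pi / 2)..(φ i₁ - Real.pi / 2 + Θ), S θ :=
    intervalIntegral.integral_nonneg (by linarith) fun θ _ => hS0 θ
  have e1 := intervalIntegral.integral_add_adjacent_intervals
    (hI (φ i₁ - Real.pi / 2) (φ i₁ + Real.pi / 2)) (hI _ (φ i₂ - Real.pi / 2))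
  have e2 := intervalIntegral.integral_add_adjacent_intervals
    (hI (φ i₁ - Real.pi / 2) (φ i₂ - Real.pi / 2)) (hI _ (φ i₂ + Real.pi / 2))
  have e3 := intervalIntegral.integral_add_adjacent_intervals
    (hI (φ i₁ - Real.pi / 2) (φ i₂ + Real.pi / 2)) (hI _ (φ i₁ - Real.pi / 2 + Θ))
  linarith

end IsConePolygon

section Polygon

open InnerProductGeometry

variable {V : Type*} [NormedAddCommGroup V] [InnerProductSpace ℝ V]

open Classical in
/-- The angle at the origin subtended by an edge; an edge with an endpoint at the origin is given
the angle `π`. -/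
noncomputable def coneTurn (x y : V) : ℝ :=
  if x = 0 ∨ y = 0 then Real.pi else angle x y

lemma angle_le_coneTurn (x y : V) : angle x y ≤ coneTurn x y := by
  unfold coneTurn
  split_ifs
  · exact angle_le_pi x y
  · exact le_rfl

lemma coneTurn_nonneg (x y : V) : 0 ≤ coneTurn x y :=
  (angle_nonneg x y).trans (angle_le_coneTurn x y)

lemma coneTurn_le_pi (x y : V) : coneTurn x y ≤ Real.pi := by
  unfold coneTurn
  split_ifs
  · exact le_rfl
  · exact angle_le_pi x y

lemma norm_mul_norm_mul_cos_coneTurn (x y : V) :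
    ‖x‖ * ‖y‖ * Real.cos (coneTurn x y) = inner ℝ x y := by
  unfold coneTurn
  split_ifs with h
  · rcases h with rfl | rfl <;> simp
  · rw [mul_comm, cos_angle_mul_norm_mul_norm]

/-- Polar angle of the `i`-th vertex in the development of the cone from the origin over a
polygonal path. -/
noncomputable def coneAngle (w : ℕ → V) (i : ℕ) : ℝ :=
  ∑ j ∈ Finset.range i, coneTurn (w j) (w (j + 1))

variable {w : ℕ → V} {n : ℕ}

lemma coneAngle_succ (w : ℕ → V) (i : ℕ) :
    coneAngle w (i + 1) = coneAngle w i + coneTurn (w i) (w (i + 1)) :=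
  Finset.sum_range_succ _ _

lemma monotone_coneAngle (w : ℕ → V) : Monotone (coneAngle w) :=
  monotone_nat_of_le_succ fun i => by
    rw [coneAngle_succ]; linarith [coneTurn_nonneg (w i) (w (i + 1))]

lemma coneAngle_add (hw : ∀ i, w (i + n) = w i) (i : ℕ) :
    coneAngle w (i + n) = coneAngle w i + coneAngle w n := by
  induction i with
  | zero => simp [coneAngle]
  | succ i ih =>
    rw [show i + 1 + n = i + n + 1 by ring, coneAngle_succ, ih, coneAngle_succ, hw,
      show i + n + 1 = i + 1 + n by ring, hw]
    ring

lemma angle_le_coneAngle_sub {i j : ℕ} (hij : i ≤ j) (hi : w i ≠ 0) :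
    angle (w i) (w j) ≤ coneAngle w j - coneAngle w i := by
  induction j, hij using Nat.le_induction with
  | base => rw [angle_self hi, sub_self]
  | succ j _ ih =>
    have h1 := angle_le_angle_add_angle (w i) (w j) (w (j + 1))
    have h2 := angle_le_coneTurn (w j) (w (j + 1))
    rw [coneAngle_succ]
    linarith

lemma norm_mul_norm_mul_cos_le_inner (i j : ℕ)
    (h : |coneAngle w j - coneAngle w i| ≤ Real.pi) :
    ‖w i‖ * ‖w j‖ * Real.cos (coneAngle w j - coneAngle w i) ≤ inner ℝ (w i) (w j) := by
  wlog hij : i ≤ j generalizing i j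
  · have := this j i (by rwa [abs_sub_comm]) (by omega)
    rwa [real_inner_comm, mul_comm ‖w i‖, ← Real.cos_neg, neg_sub]
  by_cases hi : w i = 0
  · simp [hi]
  rw [← cos_angle_mul_norm_mul_norm, mul_comm]
  exact mul_le_mul_of_nonneg_right (Real.cos_le_cos_of_nonneg_of_le_pi (angle_nonneg _ _)
    (le_of_abs_le h) (angle_le_coneAngle_sub hij hi)) (by positivity)

/-- Spherical interpolation between two directions. -/
lemma exists_angle_eq_and_angle_eq_sub {x y : V} (hx : x ≠ 0) (hy : y ≠ 0)
    (hxy : angle x y < Real.pi) {s : ℝ} (hs0 : 0 ≤ s) (hs : s ≤ angle x y) :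
    ∃ z : V, z ≠ 0 ∧ angle x z = s ∧ angle z y = angle x y - s := by
  rcases (angle_nonneg x y).eq_or_lt with h0 | h0
  · have : s = 0 := by linarith
    exact ⟨x, hx, by rw [angle_self hx, this], by rw [this, sub_zero]⟩
  set Δ := angle x y with hΔ
  have hsin : 0 < Real.sin Δ := Real.sin_pos_of_pos_of_lt_pi h0 hxy
  obtain ⟨x', hx'⟩ : ∃ x', x' = ‖x‖⁻¹ • x := ⟨_, rfl⟩
  obtain ⟨y', hy'⟩ : ∃ y', y' = ‖y‖⁻¹ • y := ⟨_, rfl⟩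
  have hxn : 0 < ‖x‖ := norm_pos_iff.2 hx
  have hyn : 0 < ‖y‖ := norm_pos_iff.2 hy
  have hxx : inner ℝ x' x' = 1 := by
    rw [real_inner_self_eq_norm_sq, hx', norm_smul, norm_inv, norm_norm,
      inv_mul_cancel₀ hxn.ne', one_pow]
  have hyy : inner ℝ y' y' = 1 := by
    rw [real_inner_self_eq_norm_sq, hy', norm_smul, norm_inv, norm_norm,
      inv_mul_cancel₀ hyn.ne', one_pow]
  have hnx : ‖x'‖ = 1 := by rw [norm_eq_sqrt_real_inner, hxx, Real.sqrt_one]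
  have hny : ‖y'‖ = 1 := by rw [norm_eq_sqrt_real_inner, hyy, Real.sqrt_one]
  have hinner : inner ℝ x' y' = Real.cos Δ := by
    rw [hx', hy', real_inner_smul_left, real_inner_smul_right, hΔ, cos_angle]
    field_simp
  set z := Real.sin (Δ - s) • x' + Real.sin s • y' with hz
  have hxz : inner ℝ x' z = Real.sin Δ * Real.cos s := by
    rw [hz, inner_add_right, real_inner_smul_right, real_inner_smul_right, hxx, hinner,
      Real.sin_sub]
    ring
  have hyz : inner ℝ y' z = Real.sin Δ * Real.cos (Δ - s) := by
    rw [hz, inner_add_right, real_inner_smul_right, real_inner_smul_right, hyy,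
      real_inner_comm, hinner, Real.sin_sub, Real.cos_sub]
    linear_combination -Real.sin s * Real.sin_sq_add_cos_sq Δ
  have hzz : inner ℝ z z = Real.sin Δ ^ 2 := by
    nth_rewrite 1 [hz]
    rw [inner_add_left, real_inner_smul_left, real_inner_smul_left, hxz, hyz]
    have := Real.sin_add (Δ - s) s
    rw [sub_add_cancel] at this
    linear_combination -Real.sin Δ * this
  have hnz : ‖z‖ = Real.sin Δ := by
    rw [norm_eq_sqrt_real_inner, hzz, Real.sqrt_sq hsin.le]
  refine ⟨z, norm_pos_iff.1 (hnz ▸ hsin), ?_, ?_⟩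
  · rw [← angle_smul_left_of_pos x z (inv_pos.2 hxn), ← hx', angle, hxz, hnx, hnz, one_mul,
      mul_div_cancel_left₀ _ hsin.ne', Real.arccos_cos hs0 (by linarith)]
  · rw [angle_comm, ← angle_smul_left_of_pos y z (inv_pos.2 hyn), ← hy', angle, hyz, hny, hnz,
      one_mul, mul_div_cancel_left₀ _ hsin.ne', Real.arccos_cos (by linarith) (by linarith)]

/-- A closed polygon subtending less than `2π` at the origin lies in an open half-space. -/
lemma exists_inner_pos_of_coneAngle_lt (hn : 0 < n) (hw : ∀ i, w (i + n) = w i)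
    (hw0 : ∀ i, w i ≠ 0) (hlt : coneAngle w n < 2 * Real.pi) :
    ∃ N : V, ∀ i, 0 < inner ℝ (w i) N := by
  set φ := coneAngle w with hφ
  have hmono : Monotone φ := monotone_coneAngle w
  have hφ0 : φ 0 = 0 := by simp [hφ, coneAngle]
  have hφn : 0 ≤ φ n := hφ0 ▸ hmono (Nat.zero_le n)
  have hwn : w n = w 0 := by simpa using hw 0
  obtain ⟨k, hkn, hk1, hk2⟩ : ∃ k < n, φ k ≤ φ n / 2 ∧ φ n / 2 ≤ φ (k + 1) := by
    have hex : ∃ k, φ n / 2 ≤ φ (k + 1) := ⟨n, by linarith [hmono (Nat.le_succ n)]⟩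
    classical
    refine ⟨Nat.find hex, ?_, ?_, Nat.find_spec hex⟩
    · have : Nat.find hex ≤ n - 1 :=
        Nat.find_min' hex (by rw [Nat.sub_add_cancel hn]; linarith)
      omega
    · rcases hm : Nat.find hex with _ | m
      · rw [hφ0]; linarith
      · exact (not_le.1 (Nat.find_min hex (by omega : m < Nat.find hex))).le
  have hturn : φ (k + 1) = φ k + angle (w k) (w (k + 1)) := by
    rw [hφ, coneAngle_succ, coneTurn, if_neg (by simp [hw0])]
  have hpi : angle (w k) (w (k + 1)) < Real.pi := by
    have h1 := angle_le_coneAngle_sub (Nat.zero_le k) (hw0 0)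
    have h2 := angle_le_coneAngle_sub (Nat.succ_le_of_lt hkn) (hw0 (k + 1))
    have h3 := angle_le_angle_add_angle (w (k + 1)) (w n) (w k)
    rw [angle_comm (w (k + 1)) (w k)] at h3
    rw [← hφ] at h1 h2
    rw [hwn] at h2 h3
    simp only [Nat.succ_eq_add_one] at h2
    linarith
  obtain ⟨z, hz0, hz1, hz2⟩ := exists_angle_eq_and_angle_eq_sub (hw0 k) (hw0 (k + 1)) hpi
    (sub_nonneg.2 hk1) (by linarith)
  have hsum : ∀ j < n, angle (w j) (w 0) + angle (w j) z < Real.pi := by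
    intro j hj
    rcases le_or_gt j k with hjk | hjk
    · have h1 := angle_le_coneAngle_sub (Nat.zero_le j) (hw0 0)
      have h2 := angle_le_coneAngle_sub hjk (hw0 j)
      have h3 := angle_le_angle_add_angle (w j) (w k) z
      rw [angle_comm] at h1
      rw [← hφ] at h1 h2
      linarith
    · have h1 := angle_le_coneAngle_sub hj.le (hw0 j)
      have h2 := angle_le_coneAngle_sub (Nat.succ_le_of_lt hjk) (hw0 (k + 1))
      have h3 := angle_le_angle_add_angle z (w (k + 1)) (w j)
      rw [angle_comm z (w j)] at h3
      rw [← hφ] at h1 h2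
      rw [hwn] at h1
      simp only [Nat.succ_eq_add_one] at h2
      linarith
  refine ⟨‖w 0‖⁻¹ • w 0 + ‖z‖⁻¹ • z, fun i => ?_⟩
  have hper : Function.Periodic w n := hw
  rw [← hper.map_mod_nat]
  set j := i % n
  have hj := hsum j (Nat.mod_lt i hn)
  have hw0n : ‖w 0‖ ≠ 0 := norm_ne_zero_iff.2 (hw0 0)
  have hzn : ‖z‖ ≠ 0 := norm_ne_zero_iff.2 hz0
  rw [inner_add_right, real_inner_smul_right, real_inner_smul_right,
    ← cos_angle_mul_norm_mul_norm (w j) (w 0), ← cos_angle_mul_norm_mul_norm (w j) z]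
  have heq : ‖w 0‖⁻¹ * (Real.cos (angle (w j) (w 0)) * (‖w j‖ * ‖w 0‖)) +
      ‖z‖⁻¹ * (Real.cos (angle (w j) z) * (‖w j‖ * ‖z‖)) =
      ‖w j‖ * (Real.cos (angle (w j) (w 0)) + Real.cos (angle (w j) z)) := by
    field_simp
  rw [heq]
  refine mul_pos (norm_pos_iff.2 (hw0 j)) ?_
  have := Real.cos_lt_cos_of_nonneg_of_le_pi (angle_nonneg (w j) (w 0))
    (by linarith [angle_nonneg (w j) z] : Real.pi - angle (w j) z ≤ Real.pi) (by linarith)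
  rw [Real.cos_pi_sub] at this
  linarith

/-- A closed polygon with the origin in its convex hull subtends at least `2π` at the origin. -/
lemma two_pi_le_coneAngle (hn : 2 ≤ n) (hw : ∀ i, w (i + n) = w i)
    (hhull : (0 : V) ∈ convexHull ℝ (Set.range w)) : 2 * Real.pi ≤ coneAngle w n := by
  by_cases hw0 : ∃ i, w i = 0
  · obtain ⟨i, hi⟩ := hw0
    have h1 : coneAngle w (i + n - 1 + n) = coneAngle w (i + n - 1) + coneAngle w n :=
      coneAngle_add hw _
    have h2 := monotone_coneAngle w (show i + n - 1 + 2 ≤ i + n - 1 + n by omega)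
    have h3 : w (i + n - 1 + 1) = 0 := by
      rw [show i + n - 1 + 1 = i + n by omega, hw, hi]
    have h4 : coneAngle w (i + n - 1 + 2) = coneAngle w (i + n - 1) + 2 * Real.pi := by
      rw [show i + n - 1 + 2 = i + n - 1 + 1 + 1 by ring, coneAngle_succ, coneAngle_succ,
        coneTurn, coneTurn, if_pos (Or.inr h3), if_pos (Or.inl h3)]
      ring
    linarith
  push Not at hw0
  by_contra! hlt
  obtain ⟨N, hN⟩ := exists_inner_pos_of_coneAngle_lt (by omega) hw hw0 hlt
  have hconv : Convex ℝ {x : V | 0 < inner ℝ x N} := by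
    refine convex_halfSpace_gt ⟨fun x y => ?_, fun c x => ?_⟩ 0
    · exact inner_add_left x y N
    · simp [real_inner_smul_left]
  have hsub : Set.range w ⊆ {x : V | 0 < inner ℝ x N} := Set.range_subset_iff.2 hN
  have h0 := convexHull_min hsub hconv hhull
  simp at h0

lemma isConePolygon (hn : 2 ≤ n) (hw : ∀ i, w (i + n) = w i)
    (hhull : (0 : V) ∈ convexHull ℝ (Set.range w)) :
    IsConePolygon n (coneAngle w n) (fun i => ‖w i‖) (coneAngle w)
      (fun i => ‖w i - w (i + 1)‖) where
  two_pi_le := two_pi_le_coneAngle hn hw hhull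
  angle_zero := by simp [coneAngle]
  radius_nonneg i := norm_nonneg _
  radius_add i := by rw [hw]
  angle_add := coneAngle_add hw
  angle_le_succ i := monotone_coneAngle w (Nat.le_succ i)
  angle_succ_le i := by rw [coneAngle_succ]; linarith [coneTurn_le_pi (w i) (w (i + 1))]
  length_nonneg i := norm_nonneg _
  length_sq i := by
    rw [coneAngle_succ, sub_add_cancel_left, Real.cos_neg, norm_sub_sq_real,
      ← norm_mul_norm_mul_cos_coneTurn]
    ring

/-- Two-point cone inequality for closed polygons. -/
lemma two_point_le_sum_norm_sub (hn : 2 ≤ n) (hw : ∀ i, w (i + n) = w i)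
    (hhull : (0 : V) ∈ convexHull ℝ (Set.range w)) {δ r : ℝ} (hr : 0 ≤ r)
    (hδ : ∀ i, ‖w i - w (i + 1)‖ ≤ δ) {k₁ k₂ : ℕ} (hk₁ : k₁ < n) (hk₂ : k₂ < n)
    {μ ν : ℝ} (hμ : μ ∈ Set.Icc (0 : ℝ) 1) (hν : ν ∈ Set.Icc (0 : ℝ) 1)
    (hx : ∀ i, r ≤ ‖w i - μ • w k₁‖) (hy : ∀ i, r ≤ ‖w i - ν • w k₂‖) :
    2 * Real.pi * (r - δ) + 2 * ‖μ • w k₁ - ν • w k₂‖ ≤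
      ∑ i ∈ Finset.range n, ‖w i - w (i + 1)‖ := by
  have hpi := Real.pi_pos
  have h := isConePolygon hn hw hhull
  wlog hk : k₁ ≤ k₂ generalizing k₁ k₂ μ ν
  · rw [norm_sub_rev]
    exact this hk₂ hk₁ hν hμ hy hx (by omega)
  have hδ0 : 0 ≤ δ := (norm_nonneg _).trans (hδ 0)
  have hdist : ∀ {κ : ℝ} {i : ℕ}, 0 ≤ κ → (∀ j, r ≤ ‖w j - κ • w i‖) → ∀ j,
      |coneAngle w j - coneAngle w i| ≤ Real.pi →
      r ^ 2 ≤ ‖w j‖ ^ 2 + (κ * ‖w i‖) ^ 2 -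
        2 * ‖w j‖ * (κ * ‖w i‖) * Real.cos (coneAngle w j - coneAngle w i) := by
    intro κ i hκ hle j hj
    have h1 := pow_le_pow_left₀ hr (hle j) 2
    have h2 := mul_le_mul_of_nonneg_left (norm_mul_norm_mul_cos_le_inner i j hj) hκ
    rw [norm_sub_sq_real, norm_smul, Real.norm_of_nonneg hκ, real_inner_smul_right,
      real_inner_comm] at h1
    linarith
  have hle : ∀ {κ : ℝ} (i : ℕ), κ ∈ Set.Icc (0 : ℝ) 1 → κ * ‖w i‖ ≤ ‖w i‖ := fun i hκ =>
    mul_le_of_le_one_left (norm_nonneg _) hκ.2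
  have hclose : ∀ {κ₁ κ₂ : ℝ} {i₁ i₂ : ℕ}, κ₁ ∈ Set.Icc (0 : ℝ) 1 → κ₂ ∈ Set.Icc (0 : ℝ) 1 →
      (∀ j, r ≤ ‖w j - κ₁ • w i₁‖) → (∀ j, r ≤ ‖w j - κ₂ • w i₂‖) →
      coneAngle w n ≤ coneAngle w i₁ → i₁ ≤ i₂ →
      coneAngle w i₂ < coneAngle w i₁ + Real.pi →
      2 * Real.pi * (r - δ) + 2 * ‖κ₁ • w i₁ - κ₂ • w i₂‖ ≤
        ∑ i ∈ Finset.range n, ‖w i - w (i + 1)‖ := by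
    intro κ₁ κ₂ i₁ i₂ hκ₁ hκ₂ h1 h2 hi₁ hi hlt
    have hmono := monotone_coneAngle w hi
    set q := (κ₁ * ‖w i₁‖) ^ 2 + (κ₂ * ‖w i₂‖) ^ 2 - 2 * (κ₁ * ‖w i₁‖) * (κ₂ * ‖w i₂‖) *
      Real.cos (coneAngle w i₁ - coneAngle w i₂) with hq
    have hnorm : ‖κ₁ • w i₁ - κ₂ • w i₂‖ ^ 2 ≤ q := by
      have h3 := mul_le_mul_of_nonneg_left (norm_mul_norm_mul_cos_le_inner (w := w) i₂ i₁
        (abs_le.2 ⟨by linarith, by linarith⟩)) (mul_nonneg hκ₁.1 hκ₂.1)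
      rw [norm_sub_sq_real, norm_smul, norm_smul, Real.norm_of_nonneg hκ₁.1,
        Real.norm_of_nonneg hκ₂.1, real_inner_smul_left, real_inner_smul_right,
        real_inner_comm]
      linarith
    have hd := h.le_sum_length_of_angle_lt_pi (d := Real.sqrt q)
      (mul_nonneg hκ₁.1 (norm_nonneg _)) (mul_nonneg hκ₂.1 (norm_nonneg _)) (Real.sqrt_nonneg _)
      hδ0 hδ (hle i₁ hκ₁) (hle i₂ hκ₂) (hdist hκ₁.1 h1) (hdist hκ₂.1 h2) hi₁ hmono hlt
      (Real.sq_sqrt ((sq_nonneg _).trans hnorm))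
    linarith [Real.le_sqrt_of_sq_le hnorm]
  have hstart : coneAngle w n ≤ coneAngle w (k₁ + n) :=
    monotone_coneAngle w (Nat.le_add_left _ _)
  have hx' : ∀ i, r ≤ ‖w i - μ • w (k₁ + n)‖ := by rwa [hw]
  have hy' : ∀ i, r ≤ ‖w i - ν • w (k₂ + n)‖ := by rwa [hw]
  rcases lt_or_ge (coneAngle w (k₂ + n)) (coneAngle w (k₁ + n) + Real.pi) with h1 | h1
  · have := hclose hμ hν hx' hy' hstart (by omega) h1
    rwa [hw, hw] at this
  rcases lt_or_ge (coneAngle w (k₁ + n + n)) (coneAngle w (k₂ + n) + Real.pi) with h2 | h2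
  · have := hclose hν hμ hy' (by rwa [hw]) (by linarith) (by omega) h2
    rwa [hw, hw, hw, norm_sub_rev] at this
  rw [coneAngle_add hw (k₁ + n)] at h2
  have hd := h.le_sum_length_of_pi_le_angle (mul_nonneg hμ.1 (norm_nonneg _))
    (mul_nonneg hν.1 (norm_nonneg _)) hδ0 hδ (hle (k₁ + n) hμ) (hle (k₂ + n) hν)
    (hdist hμ.1 hx') (hdist hν.1 hy') hstart h1 h2
  have htri := norm_sub_le (μ • w k₁) (ν • w k₂)
  rw [norm_smul, norm_smul, Real.norm_of_nonneg hμ.1, Real.norm_of_nonneg hν.1] at htri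
  rw [hw, hw] at hd
  linarith

end Polygon

section Subdivision

/-- A fine subdivision of the unit interval through prescribed points. -/
lemma exists_subdivision_unitInterval (G : Finset ℝ) (hG : ∀ t ∈ G, t ∈ Set.Icc (0 : ℝ) 1)
    {η : ℝ} (hη : 0 < η) :
    ∃ (n : ℕ) (u : ℕ → ℝ), 2 ≤ n ∧ Monotone u ∧ (∀ i, u i ∈ Set.Icc (0 : ℝ) 1) ∧ u 0 = 0 ∧
      u n = 1 ∧ (∀ i, u (i + 1) - u i ≤ η) ∧ ∀ t ∈ G, ∃ i ≤ n, u i = t := by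
  obtain ⟨m, hm⟩ := exists_nat_gt η⁻¹
  have hm0 : (0 : ℝ) < m := (inv_pos.2 hη).trans hm
  have hmη : (m : ℝ)⁻¹ < η := inv_lt_of_inv_lt₀ hη hm
  obtain ⟨F, hF⟩ : ∃ F : Finset ℝ, F = G ∪ {0, 1 / 2, 1} ∪
    (Finset.range (m + 1)).image fun k : ℕ => (k : ℝ) / m := ⟨_, rfl⟩
  have hF01 : ∀ t ∈ F, t ∈ Set.Icc (0 : ℝ) 1 := by
    intro t ht
    simp only [hF, Finset.mem_union, Finset.mem_insert, Finset.mem_singleton, Finset.mem_image,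
      Finset.mem_range] at ht
    rcases ht with (ht | rfl | rfl | rfl) | ⟨k, hk, rfl⟩
    · exact hG t ht
    · norm_num
    · norm_num
    · norm_num
    · refine ⟨by positivity, (div_le_one hm0).2 ?_⟩
      exact_mod_cast Nat.lt_succ_iff.1 hk
  have hcard : 3 ≤ F.card := by
    have h3 : ({0, 1 / 2, 1} : Finset ℝ).card = 3 := by
      rw [Finset.card_eq_three]
      exact ⟨0, 1 / 2, 1, by norm_num, by norm_num, by norm_num, rfl⟩
    rw [← h3]
    refine Finset.card_le_card fun t ht => ?_
    rw [hF]
    exact Finset.mem_union_left _ (Finset.mem_union_right _ ht)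
  obtain ⟨n, hn⟩ : ∃ n, F.card = n + 1 := ⟨F.card - 1, by omega⟩
  obtain ⟨e, he⟩ : ∃ e : Fin (n + 1) ↪o ℝ, Set.range e = F :=
    ⟨F.orderEmbOfFin hn, F.range_orderEmbOfFin hn⟩
  have hmem : ∀ i, e i ∈ Set.Icc (0 : ℝ) 1 := fun i =>
    hF01 _ (Finset.mem_coe.1 (he ▸ Set.mem_range_self i))
  have hsurj : ∀ t ∈ F, ∃ i, e i = t := fun t ht => by
    rw [← Finset.mem_coe, ← he] at ht
    exact ht
  have hFG : ∀ t ∈ G, t ∈ F := fun t ht => by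
    rw [hF]
    exact Finset.mem_union_left _ (Finset.mem_union_left _ ht)
  have hmin : ∀ i, min i n < n + 1 := fun i => by omega
  refine ⟨n, fun i => e ⟨min i n, hmin i⟩, by omega, fun i j hij => ?_, fun i => hmem _, ?_, ?_,
    fun i => ?_, fun t ht => ?_⟩
  · exact e.monotone (min_le_min_right n hij)
  · obtain ⟨i, hi⟩ := hsurj 0 (by simp [hF])
    refine le_antisymm ?_ (hmem _).1
    rw [← hi]
    exact e.monotone (Fin.le_def.2 (by simp))
  · obtain ⟨i, hi⟩ := hsurj 1 (by simp [hF])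
    refine le_antisymm (hmem _).2 ?_
    rw [← hi]
    exact e.monotone (Fin.le_def.2 (by simp; omega))
  · by_contra! hgap
    obtain ⟨a, ha⟩ : ∃ a, a = e ⟨min i n, hmin i⟩ := ⟨_, rfl⟩
    obtain ⟨b, hb⟩ : ∃ b, b = e ⟨min (i + 1) n, hmin (i + 1)⟩ := ⟨_, rfl⟩
    rw [← ha, ← hb] at hgap
    have ha0 : 0 ≤ a := ha ▸ (hmem _).1
    have hb1 : b ≤ 1 := hb ▸ (hmem _).2
    obtain ⟨c, hc⟩ : ∃ c : ℝ, c = ((⌊a * m⌋₊ + 1 : ℕ) : ℝ) / m := ⟨_, rfl⟩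
    have hac : a < c := by
      rw [hc, lt_div_iff₀ hm0]
      push_cast
      exact Nat.lt_floor_add_one _
    have hcb : c < b := by
      have : c ≤ a + (m : ℝ)⁻¹ := by
        rw [hc, div_le_iff₀ hm0, add_mul, inv_mul_cancel₀ hm0.ne']
        push_cast
        linarith [Nat.floor_le (mul_nonneg ha0 hm0.le)]
      linarith
    have hcF : c ∈ F := by
      have hk : ⌊a * m⌋₊ + 1 < m + 1 := by
        have : ((⌊a * m⌋₊ + 1 : ℕ) : ℝ) < m := by
          have := hcb.trans_le hb1
          rwa [hc, div_lt_one hm0] at this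
        have : ⌊a * m⌋₊ + 1 < m := by exact_mod_cast this
        omega
      rw [hF]
      exact Finset.mem_union_right _ (Finset.mem_image.2 ⟨_, Finset.mem_range.2 hk, hc.symm⟩)
    obtain ⟨j, hj⟩ := hsurj c hcF
    rw [← hj, ha, e.lt_iff_lt, Fin.lt_def] at hac
    rw [← hj, hb, e.lt_iff_lt, Fin.lt_def] at hcb
    simp only at hac hcb
    omega
  · obtain ⟨i, hi⟩ := hsurj t (hFG t ht)
    refine ⟨i, by omega, ?_⟩
    rw [← hi]
    exact congrArg e (Fin.ext (min_eq_left (by omega)))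

end Subdivision

section Curve

variable {E : Type*} [NormedAddCommGroup E] [InnerProductSpace ℝ E]

/-- The two-point cone inequality for a closed curve, up to an arbitrarily small error. -/
lemma ofReal_two_point_sub_le_eVariationOn {C : ℝ → E} (hC : ContinuousOn C (Set.Icc 0 1))
    (hclosed : C 0 = C 1) {p : E} (hp : p ∈ convexHull ℝ (C '' Set.Icc 0 1)) {r δ : ℝ}
    (hr : 0 ≤ r) (hδ : 0 < δ) {s t μ ν : ℝ} (hs : s ∈ Set.Icc (0 : ℝ) 1)
    (ht : t ∈ Set.Icc (0 : ℝ) 1) (hμ : μ ∈ Set.Icc (0 : ℝ) 1) (hν : ν ∈ Set.Icc (0 : ℝ) 1)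
    (hx : ∀ τ ∈ Set.Icc (0 : ℝ) 1, r ≤ ‖C τ - p - μ • (C s - p)‖)
    (hy : ∀ τ ∈ Set.Icc (0 : ℝ) 1, r ≤ ‖C τ - p - ν • (C t - p)‖) :
    ENNReal.ofReal (2 * Real.pi * (r - δ) + 2 * ‖μ • (C s - p) - ν • (C t - p)‖) ≤
      eVariationOn C (Set.Icc 0 1) := by
  classical
  obtain ⟨η, hη, hCη⟩ := Metric.uniformContinuousOn_iff.1
    (isCompact_Icc.uniformContinuousOn_of_continuous hC) δ hδ
  obtain ⟨G, hG, hpG⟩ : ∃ G : Finset ℝ, (∀ τ ∈ G, τ ∈ Set.Icc (0 : ℝ) 1) ∧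
      p ∈ convexHull ℝ (C '' G) := by
    rw [convexHull_eq_union_convexHull_finite_subsets] at hp
    simp only [Set.mem_iUnion] at hp
    obtain ⟨T, hT, hpT⟩ := hp
    obtain ⟨G, hG, hGT⟩ := Finset.subset_set_image_iff.1 hT
    refine ⟨G, fun τ hτ => hG hτ, ?_⟩
    rwa [← hGT, Finset.coe_image] at hpT
  obtain ⟨n, u, hn, hu, hu01, hu0, hun, hgap, hmem⟩ :=
    exists_subdivision_unitInterval (G ∪ {s, t}) (by
      intro τ hτ
      simp only [Finset.mem_union, Finset.mem_insert, Finset.mem_singleton] at hτ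
      rcases hτ with hτ | rfl | rfl
      exacts [hG _ hτ, hs, ht]) (half_pos hη)
  obtain ⟨w, hw⟩ : ∃ w : ℕ → E, ∀ i, w i = C (u (i % n)) - p := ⟨_, fun _ => rfl⟩
  have hper : ∀ i, w (i + n) = w i := fun i => by rw [hw, hw, Nat.add_mod_right]
  have hwle : ∀ i ≤ n, w i = C (u i) - p := by
    intro i hi
    rcases hi.lt_or_eq with hi | rfl
    · rw [hw, Nat.mod_eq_of_lt hi]
    · rw [hw, Nat.mod_self, hu0, hun, hclosed]
  have hsurj : ∀ τ ∈ G ∪ {s, t}, ∃ k < n, w k = C τ - p := by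
    intro τ hτ
    obtain ⟨i, hi, rfl⟩ := hmem τ hτ
    refine ⟨i % n, Nat.mod_lt _ (by omega), ?_⟩
    rw [← hwle i hi, hw, hw, Nat.mod_mod]
  have hhull : (0 : E) ∈ convexHull ℝ (Set.range w) := by
    have hsub : C '' G ⊆ (fun x => x + p) '' Set.range w := by
      rintro _ ⟨τ, hτ, rfl⟩
      obtain ⟨k, -, hk⟩ := hsurj τ (Finset.mem_union_left _ hτ)
      exact ⟨w k, ⟨k, rfl⟩, by simp [hk]⟩
    have h := convexHull_mono hsub hpG
    have himg : convexHull ℝ ((fun x => x + p) '' Set.range w) =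
        (fun x => x + p) '' convexHull ℝ (Set.range w) :=
      ((AffineEquiv.vaddConst ℝ p).toAffineMap.image_convexHull (Set.range w)).symm
    rw [himg] at h
    obtain ⟨x, hx, hxp⟩ := h
    have hx0 : x = 0 := by simpa using hxp
    rwa [hx0] at hx
  have hedge : ∀ i, ‖w i - w (i + 1)‖ ≤ δ := by
    intro i
    have hi : i % n < n := Nat.mod_lt _ (by omega)
    have h1 : w i = w (i % n) := by rw [hw, hw, Nat.mod_mod]
    have h2 : w (i + 1) = w (i % n + 1) := by rw [hw, hw, Nat.mod_add_mod]
    rw [h1, h2, hwle _ hi.le, hwle _ hi, sub_sub_sub_cancel_right, ← dist_eq_norm]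
    refine (hCη _ (hu01 _) _ (hu01 _) ?_).le
    rw [dist_comm, Real.dist_eq, abs_of_nonneg (sub_nonneg.2 (hu (Nat.le_succ _)))]
    linarith [hgap (i % n)]
  obtain ⟨k₁, hk₁, hwk₁⟩ := hsurj s (by simp)
  obtain ⟨k₂, hk₂, hwk₂⟩ := hsurj t (by simp)
  have key := two_point_le_sum_norm_sub hn hper hhull hr hedge hk₁ hk₂ hμ hν
    (fun i => by rw [hwk₁, hw]; exact hx _ (hu01 _))
    (fun i => by rw [hwk₂, hw]; exact hy _ (hu01 _))
  rw [hwk₁, hwk₂] at key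
  refine (ENNReal.ofReal_le_ofReal key).trans ?_
  rw [ENNReal.ofReal_sum_of_nonneg fun _ _ => norm_nonneg _]
  refine le_trans (Finset.sum_le_sum fun i hi => ?_)
    (eVariationOn.sum_le (f := C) (n := n) hu hu01)
  have hi := Finset.mem_range.1 hi
  rw [hwle i hi.le, hwle (i + 1) hi, sub_sub_sub_cancel_right, ← dist_eq_norm, ← edist_dist,
    edist_comm]

/-- The two-point cone inequality for a closed curve. -/
lemma ofReal_two_point_le_eVariationOn {C : ℝ → E} (hC : ContinuousOn C (Set.Icc 0 1))
    (hclosed : C 0 = C 1) {p : E} (hp : p ∈ convexHull ℝ (C '' Set.Icc 0 1)) {r : ℝ}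
    (hr : 0 ≤ r) {s t μ ν : ℝ} (hs : s ∈ Set.Icc (0 : ℝ) 1)
    (ht : t ∈ Set.Icc (0 : ℝ) 1) (hμ : μ ∈ Set.Icc (0 : ℝ) 1) (hν : ν ∈ Set.Icc (0 : ℝ) 1)
    (hx : ∀ τ ∈ Set.Icc (0 : ℝ) 1, r ≤ ‖C τ - p - μ • (C s - p)‖)
    (hy : ∀ τ ∈ Set.Icc (0 : ℝ) 1, r ≤ ‖C τ - p - ν • (C t - p)‖) :
    ENNReal.ofReal (2 * Real.pi * r + 2 * ‖μ • (C s - p) - ν • (C t - p)‖) ≤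
      eVariationOn C (Set.Icc 0 1) := by
  have hlim : Filter.Tendsto (fun δ : ℝ => ENNReal.ofReal
      (2 * Real.pi * (r - δ) + 2 * ‖μ • (C s - p) - ν • (C t - p)‖)) (nhdsWithin 0 (Set.Ioi 0))
      (nhds (ENNReal.ofReal (2 * Real.pi * r + 2 * ‖μ • (C s - p) - ν • (C t - p)‖))) := by
    refine (ENNReal.continuous_ofReal.tendsto' _ _ rfl).comp
      (Filter.Tendsto.mono_left ?_ nhdsWithin_le_nhds)
    exact Continuous.tendsto' (by fun_prop) _ _ (by simp)
  refine le_of_tendsto hlim ?_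
  filter_upwards [self_mem_nhdsWithin] with δ hδ
  exact ofReal_two_point_sub_le_eVariationOn hC hclosed hp hr hδ hs ht hμ hν hx hy

/-- The `p`-cone over a compact curve is proximinal. -/
lemma exists_dist_cone_le {C : ℝ → E} (hC : ContinuousOn C (Set.Icc 0 1)) (p : E) {u : E} {ε : ℝ}
    (hu : Metric.infDist u {z | ∃ x ∈ Set.Icc (0 : ℝ) 1, ∃ y ∈ Set.Icc (0 : ℝ) 1,
      z = y • C x + (1 - y) • p} ≤ ε) :
    ∃ s ∈ Set.Icc (0 : ℝ) 1, ∃ μ ∈ Set.Icc (0 : ℝ) 1, dist u (p + μ • (C s - p)) ≤ ε := by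
  have hK : {z | ∃ x ∈ Set.Icc (0 : ℝ) 1, ∃ y ∈ Set.Icc (0 : ℝ) 1, z = y • C x + (1 - y) • p} =
      (fun q : ℝ × ℝ => q.2 • C q.1 + (1 - q.2) • p) '' Set.Icc 0 1 ×ˢ Set.Icc 0 1 := by
    ext z
    constructor
    · rintro ⟨x, hx, y, hy, rfl⟩
      exact ⟨(x, y), ⟨hx, hy⟩, rfl⟩
    · rintro ⟨⟨x, y⟩, ⟨hx, hy⟩, rfl⟩
      exact ⟨x, hx, y, hy, rfl⟩
  rw [hK] at hu
  have hcomp : IsCompact ((fun q : ℝ × ℝ => q.2 • C q.1 + (1 - q.2) • p) ''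
      Set.Icc 0 1 ×ˢ Set.Icc 0 1) := by
    refine (isCompact_Icc.prod isCompact_Icc).image_of_continuousOn ?_
    have : ContinuousOn (fun q : ℝ × ℝ => C q.1) (Set.Icc 0 1 ×ˢ Set.Icc 0 1) :=
      hC.comp continuousOn_fst fun q hq => hq.1
    exact (continuousOn_snd.smul this).add (by fun_prop)
  obtain ⟨_, ⟨⟨s, μ⟩, ⟨hs, hμ⟩, rfl⟩, hz⟩ := hcomp.exists_infDist_eq_dist
    ⟨_, Set.mem_image_of_mem _ (show ((0 : ℝ), (0 : ℝ)) ∈ Set.Icc 0 1 ×ˢ Set.Icc 0 1 by simp)⟩ u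
  refine ⟨s, hs, μ, hμ, ?_⟩
  rw [hz] at hu
  convert hu using 2
  module

end Curve

open Metric

/-- Approximate two-point cone inequality: if `u, v` keep distance at least `1` from
the closed curve `C` and lie within `ε` of the `p`-cone of `C`, then
`len(C) ≥ 2π + 2‖u - v‖ - (2π + 4)ε`. -/
theorem cone_two_point_inequality_eps
    (C : ℝ → EuclideanSpace ℝ (Fin 3))
    (hC : ContinuousOn C (Set.Icc 0 1)) (hclosed : C 0 = C 1)
    (p : EuclideanSpace ℝ (Fin 3))
    (hp : p ∈ convexHull ℝ (C '' Set.Icc 0 1))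
    (ε : ℝ) (hε : ε ∈ Set.Icc (0:ℝ) 1)
    (u v : EuclideanSpace ℝ (Fin 3))
    (hud : ∀ t ∈ Set.Icc (0:ℝ) 1, 1 ≤ dist u (C t))
    (hvd : ∀ t ∈ Set.Icc (0:ℝ) 1, 1 ≤ dist v (C t))
    (huK : Metric.infDist u {z | ∃ x ∈ Set.Icc (0:ℝ) 1, ∃ y ∈ Set.Icc (0:ℝ) 1,
      z = y • C x + (1 - y) • p} ≤ ε)
    (hvK : Metric.infDist v {z | ∃ x ∈ Set.Icc (0:ℝ) 1, ∃ y ∈ Set.Icc (0:ℝ) 1,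
      z = y • C x + (1 - y) • p} ≤ ε) :
    ENNReal.ofReal (2 * Real.pi + 2 * dist u v - (2 * Real.pi + 4) * ε) ≤
      eVariationOn C (Set.Icc 0 1) := by
  have hdist : ∀ {q q' : EuclideanSpace ℝ (Fin 3)}, dist q (p + q') ≤ ε →
      (∀ t ∈ Set.Icc (0 : ℝ) 1, 1 ≤ dist q (C t)) →
      ∀ t ∈ Set.Icc (0 : ℝ) 1, 1 - ε ≤ ‖C t - p - q'‖ := by
    intro q q' hq hqC t ht
    have h := dist_triangle q (p + q') (C t)
    rw [dist_comm (p + q'), dist_eq_norm (C t), ← sub_sub] at h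
    linarith [hqC t ht]
  obtain ⟨s, hs, μ, hμ, hus⟩ := exists_dist_cone_le hC p huK
  obtain ⟨t, ht, ν, hν, hvt⟩ := exists_dist_cone_le hC p hvK
  refine le_trans (ENNReal.ofReal_le_ofReal ?_)
    (ofReal_two_point_le_eVariationOn hC hclosed hp (sub_nonneg.2 hε.2) hs ht hμ hν
      (hdist hus hud) (hdist hvt hvd))
  have h := dist_triangle4 u (p + μ • (C s - p)) (p + ν • (C t - p)) v
  rw [dist_add_left, dist_eq_norm (μ • _), dist_comm (p + _) v] at h
  linarith
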